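/- arXiv:math/0612630 — 3 statements merged into one kernel-verified Lean document; each statement's English description precedes it below -/
import Mathlib

section
/- Let M ≥ 1 and let χ : (-∞, 0] → (-∞, 0] be a concave, increasing function, differentiable on (-∞, 0), with χ(0) = 0, χ(t) → -∞ as t → -∞, and such that -t·χ'(t) ≤ M·(-χ(t)) for all t < 0. Then for every ε with 0 ≤ ε ≤ 1 and every t < -1 one has ε^M·|χ(t)| ≤ |χ(ε·t)| ≤ ε·|χ(t)|. -/
open Set Filter

/-- If `s * f' s ≤ M * f s` for all `s > 0`, then `s ↦ s ^ (-M) * f s` is nonincreasing. -/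
theorem antitoneOn_rpow_neg_mul_of_mul_deriv_le {M : ℝ} {f : ℝ → ℝ}
    (hf : ∀ s, 0 < s → DifferentiableAt ℝ f s)
    (hM : ∀ s, 0 < s → s * deriv f s ≤ M * f s) :
    AntitoneOn (fun s : ℝ => s ^ (-M) * f s) (Ioi 0) := by
  have hder : ∀ s : ℝ, 0 < s → HasDerivAt (fun s : ℝ => s ^ (-M) * f s)
      (-M * s ^ (-M - 1) * f s + s ^ (-M) * deriv f s) s := fun s hs =>
    (Real.hasDerivAt_rpow_const (Or.inl hs.ne')).mul (hf s hs).hasDerivAt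
  refine antitoneOn_of_deriv_nonpos (convex_Ioi 0)
    (fun s hs => (hder s hs).continuousAt.continuousWithinAt)
    (fun s hs => (hder s (interior_subset hs)).differentiableAt.differentiableWithinAt) ?_
  intro s hs
  have hs : 0 < s := interior_subset hs
  rw [(hder s hs).deriv]
  have hpow : s ^ (-M) = s ^ (-M - 1) * s := by
    rw [Real.rpow_sub_one hs.ne', div_mul_cancel₀ _ hs.ne']
  calc -M * s ^ (-M - 1) * f s + s ^ (-M) * deriv f s
      = s ^ (-M - 1) * (s * deriv f s - M * f s) := by rw [hpow]; ring
    _ ≤ 0 := mul_nonpos_of_nonneg_of_nonpos (Real.rpow_nonneg hs.le _)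
        (sub_nonpos.mpr (hM s hs))

/-- If `s * f' s ≤ M * f s` for all `s > 0`, then `ε ^ M * f s ≤ f (ε * s)` for `0 < ε ≤ 1`. -/
theorem rpow_mul_le_of_mul_deriv_le {M : ℝ} {f : ℝ → ℝ}
    (hf : ∀ s, 0 < s → DifferentiableAt ℝ f s)
    (hM : ∀ s, 0 < s → s * deriv f s ≤ M * f s)
    {ε s : ℝ} (hε : 0 < ε) (hε1 : ε ≤ 1) (hs : 0 < s) :
    ε ^ M * f s ≤ f (ε * s) := by
  have hεs : 0 < ε * s := mul_pos hε hs
  have h : s ^ (-M) * f s ≤ (ε * s) ^ (-M) * f (ε * s) :=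
    antitoneOn_rpow_neg_mul_of_mul_deriv_le hf hM hεs hs (mul_le_of_le_one_left hs.le hε1)
  have hcancel : ∀ x : ℝ, 0 < x → x ^ M * x ^ (-M) = 1 := fun x hx => by
    rw [← Real.rpow_add hx, add_neg_cancel, Real.rpow_zero]
  calc ε ^ M * f s = (ε * s) ^ M * (s ^ (-M) * f s) := by
        rw [Real.mul_rpow hε.le hs.le]
        linear_combination -(ε ^ M * f s) * hcancel s hs
    _ ≤ (ε * s) ^ M * ((ε * s) ^ (-M) * f (ε * s)) := by gcongr
    _ = f (ε * s) := by rw [← mul_assoc, hcancel _ hεs, one_mul]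

/-- **Lemma 3.7** (weak homogeneity of weights in `W_M^+`).
Let `M ≥ 1` and `χ : (-∞,0] → (-∞,0]` be a concave increasing function,
differentiable on `(-∞,0)`, with `χ 0 = 0`, `χ t → -∞` as `t → -∞`, and
`-t * χ' t ≤ M * (-χ t)` for `t < 0`. Then for `0 ≤ ε ≤ 1` and `t < -1`,
`ε ^ M * |χ t| ≤ |χ (ε * t)| ≤ ε * |χ t|`. -/
theorem weak_homogeneity_of_WMplus_weight
    (M : ℝ) (hM : 1 ≤ M) (χ : ℝ → ℝ)
    (hconc : ConcaveOn ℝ (Iic 0) χ)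
    (hmono : MonotoneOn χ (Iic 0))
    (hdiff : ∀ t < (0 : ℝ), DifferentiableAt ℝ χ t)
    (hχ0 : χ 0 = 0)
    (hχneg : ∀ t ≤ (0 : ℝ), χ t ≤ 0)
    (hbot : Tendsto χ atBot atBot)
    (hMbound : ∀ t < (0 : ℝ), -t * deriv χ t ≤ M * (-χ t)) :
    ∀ ε : ℝ, 0 ≤ ε → ε ≤ 1 → ∀ t : ℝ, t < -1 →
      ε ^ M * |χ t| ≤ |χ (ε * t)| ∧ |χ (ε * t)| ≤ ε * |χ t| := by
  intro ε hε hε1 t ht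
  have ht0 : t < 0 := by linarith
  rw [abs_of_nonpos (hχneg t ht0.le),
    abs_of_nonpos (hχneg _ (mul_nonpos_of_nonneg_of_nonpos hε ht0.le))]
  constructor
  · rcases hε.eq_or_lt with rfl | hε
    · simp [hχ0, Real.zero_rpow (zero_lt_one.trans_le hM).ne']
    have hder : ∀ s : ℝ, 0 < s →
        HasDerivAt (fun s => -χ (-s)) (deriv χ (-s)) s := fun s hs => by
      have h := ((hdiff (-s) (neg_lt_zero.mpr hs)).hasDerivAt.comp s (hasDerivAt_neg s)).neg
      rw [mul_neg_one, neg_neg] at h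
      exact h
    have h := rpow_mul_le_of_mul_deriv_le (M := M)
      (fun s hs => (hder s hs).differentiableAt)
      (fun s hs => by
        rw [(hder s hs).deriv]
        simpa using hMbound (-s) (neg_lt_zero.mpr hs))
      hε hε1 (neg_pos.mpr ht0)
    simpa using h
  · have h := hconc.2 (mem_Iic.mpr ht0.le) (mem_Iic.mpr le_rfl) hε (sub_nonneg.mpr hε1)
      (add_sub_cancel ε 1)
    simp only [smul_eq_mul, mul_zero, add_zero, hχ0] at h
    linarith
end

section
/- Let μ be a finite measure on a measurable space X and let g : X → [0, ∞] be a measurable function. Assume that for every continuous, convex, increasing function h : [0, ∞) → [0, ∞) with h(0) = 0 and h(t) → ∞ as t → ∞, the composition h ∘ g is μ-integrable (where h ∘ g is interpreted as +∞ on the set {g = ∞}). Then g is μ-essentially bounded: there exists t∞ ∈ [0, ∞) with μ({x : g(x) > t∞}) = 0. -/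
open Set Filter MeasureTheory ENNReal

/-- The integral of a monotone function over `[x, y]` is at least `φ x * (y - x)`. -/
theorem Monotone.mul_sub_le_intervalIntegral {φ : ℝ → ℝ} (hφ : Monotone φ) {x y : ℝ}
    (hxy : x ≤ y) : φ x * (y - x) ≤ ∫ s in x..y, φ s := by
  have h := intervalIntegral.integral_mono_on (μ := volume) hxy
    (intervalIntegrable_const (c := φ x)) hφ.intervalIntegrable fun s hs => hφ hs.1
  rw [intervalIntegral.integral_const, smul_eq_mul] at h
  linarith

/-- The integral of a monotone function over `[x, y]` is at most `φ y * (y - x)`. -/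
theorem Monotone.intervalIntegral_le_mul_sub {φ : ℝ → ℝ} (hφ : Monotone φ) {x y : ℝ}
    (hxy : x ≤ y) : ∫ s in x..y, φ s ≤ φ y * (y - x) := by
  have h := intervalIntegral.integral_mono_on (μ := volume) hxy
    hφ.intervalIntegrable (intervalIntegrable_const (c := φ y)) fun s hs => hφ hs.2
  rw [intervalIntegral.integral_const, smul_eq_mul] at h
  linarith

/-- A primitive of a monotone function is convex. -/
theorem Monotone.convexOn_primitive {φ : ℝ → ℝ} (hφ : Monotone φ) (a : ℝ) :
    ConvexOn ℝ univ fun t => ∫ s in a..t, φ s := by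
  refine convexOn_of_slope_mono_adjacent convex_univ fun {x y z} _ _ hxy hyz => ?_
  rw [intervalIntegral.integral_interval_sub_left hφ.intervalIntegrable hφ.intervalIntegrable,
    intervalIntegral.integral_interval_sub_left hφ.intervalIntegrable hφ.intervalIntegrable]
  calc _ ≤ φ y := (div_le_iff₀ (sub_pos.2 hxy)).2 (hφ.intervalIntegral_le_mul_sub hxy.le)
    _ ≤ _ := (le_div_iff₀ (sub_pos.2 hyz)).2 (hφ.mul_sub_le_intervalIntegral hyz.le)

/-- **Measure-theoretic core of Proposition 3.1.**
If `μ` is a finite measure and `g : X → [0,∞]` is measurable, and for every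
continuous convex increasing `h : [0,∞) → [0,∞)` with `h 0 = 0` and
`h t → ∞` as `t → ∞` the composition `h ∘ g` (set to `+∞` where `g = ∞`)
is `μ`-integrable, then `g` is `μ`-essentially bounded. -/
theorem essentially_bounded_of_integrable_all_convex_weights
    {X : Type*} [MeasurableSpace X] (μ : Measure X) [IsFiniteMeasure μ]
    (g : X → ℝ≥0∞) (hg : Measurable g)
    (H : ∀ h : ℝ → ℝ, ContinuousOn h (Ici 0) → ConvexOn ℝ (Ici 0) h →
      MonotoneOn h (Ici 0) → (∀ t, 0 ≤ t → 0 ≤ h t) → h 0 = 0 →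
      Tendsto h atTop atTop →
      ∫⁻ x, (if g x = ⊤ then ⊤ else ENNReal.ofReal (h (g x).toReal)) ∂μ < ⊤) :
    ∃ t : ℝ, 0 ≤ t ∧ μ {x | ENNReal.ofReal t < g x} = 0 := by
  by_contra! hpos
  set m : ℝ → ℝ := fun t => μ.real {x | ENNReal.ofReal t < g x}
  have hm_anti : Antitone m := fun s t hst =>
    measureReal_mono fun x hx => (ENNReal.ofReal_le_ofReal hst).trans_lt hx
  have hm_pos (t : ℝ) : 0 < m t :=
    (ENNReal.toReal_pos (hpos _ (le_max_right t 0)) (measure_ne_top _ _)).trans_le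
      (hm_anti (le_max_left t 0))
  set φ : ℝ → ℝ := fun s => max s 0 / m (s + 1) with hφ_def
  have hφ : Monotone φ := fun s t hst =>
    div_le_div₀ (le_max_right _ _) (max_le_max_right 0 hst) (hm_pos _)
      (hm_anti (by linarith))
  have hφ_nonneg (s : ℝ) : 0 ≤ φ s := div_nonneg (le_max_right _ _) (hm_pos _).le
  set h : ℝ → ℝ := fun t => ∫ s in (0 : ℝ)..t, φ s
  have h_sub (x y : ℝ) : h y - h x = ∫ s in x..y, φ s :=
    intervalIntegral.integral_interval_sub_left hφ.intervalIntegrable hφ.intervalIntegrable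
  have h_mono : Monotone h := fun x y hxy => by
    rw [← sub_nonneg, h_sub]
    exact intervalIntegral.integral_nonneg hxy fun s _ => hφ_nonneg s
  have h_zero : h 0 = 0 := intervalIntegral.integral_same
  have h_nonneg (t : ℝ) (ht : 0 ≤ t) : 0 ≤ h t := h_zero ▸ h_mono ht
  have h_cont : Continuous h :=
    intervalIntegral.continuous_primitive (fun _ _ => hφ.intervalIntegrable) 0
  have h_lower {s t : ℝ} (hs : 0 ≤ s) (hst : s ≤ t) : φ s * (t - s) ≤ h t := by
    have h1 := hφ.mul_sub_le_intervalIntegral hst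
    have h2 := h_nonneg s hs
    linarith [h_sub s t]
  have h_top : Tendsto h atTop atTop := by
    have hφ1 : 0 < φ 1 := div_pos (by norm_num) (hm_pos _)
    refine tendsto_atTop_mono' atTop ?_
      ((tendsto_atTop_add_const_right atTop (-1 : ℝ) tendsto_id).const_mul_atTop hφ1)
    filter_upwards [eventually_ge_atTop (1 : ℝ)] with t ht
    exact h_lower zero_le_one ht
  have hfin := H h h_cont.continuousOn ((hφ.convexOn_primitive 0).subset (subset_univ _)
    (convex_Ici 0)) (h_mono.monotoneOn _) h_nonneg h_zero h_top
  refine hfin.ne (ENNReal.eq_top_of_forall_nnreal_le fun r => ?_)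
  have hmeas : MeasurableSet {x | ENNReal.ofReal (r + 1) < g x} :=
    measurableSet_lt measurable_const hg
  calc (r : ℝ≥0∞) ≤ ENNReal.ofReal (h (r + 1)) * μ {x | ENNReal.ofReal (r + 1) < g x} := by
        rw [← ofReal_measureReal, ← ENNReal.ofReal_mul (h_nonneg _ (by positivity)),
          ← ENNReal.ofReal_coe_nnreal]
        refine ENNReal.ofReal_le_ofReal ((div_le_iff₀ (hm_pos (r + 1))).1 ?_)
        have := h_lower r.coe_nonneg (le_add_of_nonneg_right zero_le_one)
        simpa [hφ_def] using this
    _ = ∫⁻ _ in {x | ENNReal.ofReal (r + 1) < g x}, ENNReal.ofReal (h (r + 1)) ∂μ :=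
        (setLIntegral_const _ _).symm
    _ ≤ ∫⁻ x in {x | ENNReal.ofReal (r + 1) < g x},
          (if g x = ⊤ then ⊤ else ENNReal.ofReal (h (g x).toReal)) ∂μ := by
        refine setLIntegral_mono' hmeas fun x hx => ?_
        split_ifs with hx_top
        · exact le_top
        · exact ENNReal.ofReal_le_ofReal
            (h_mono ((ENNReal.ofReal_le_iff_le_toReal hx_top).1 (le_of_lt hx)))
    _ ≤ _ := setLIntegral_le_lintegral _ _
end

section
/- Let ν be a finite measure on a measurable space X and let f : X → [0, ∞) be a ν-integrable function. Then there exist a continuous, convex, increasing function χ : (-∞, 0] → (-∞, 0] with χ(t) → -∞ as t → -∞ and a constant C ≥ 0 such that for every measurable function φ : X → [-∞, 0], one has ∫_X (-χ)(φ(x))·f(x) dν(x) ≤ ∫_X (-φ(x)) dν(x) + C, as an inequality in [0, ∞] (with the convention (-χ)(-∞) = +∞). -/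
open Set Filter MeasureTheory ENNReal

/-- The mass of an integrable function above level `n` tends to zero. -/
lemma tendsto_lintegral_ofReal_sub_nat {X : Type*} [MeasurableSpace X] {ν : Measure X}
    {f : X → ℝ} (hf_meas : Measurable f) (hf_int : Integrable f ν) :
    Tendsto (fun n : ℕ => ∫⁻ x, ENNReal.ofReal (f x - n) ∂ν) atTop (nhds 0) := by
  have h := tendsto_lintegral_of_dominated_convergence
    (F := fun (n : ℕ) x => ENNReal.ofReal (f x - n)) (f := fun _ => 0) (μ := ν)
    (fun x => ENNReal.ofReal (f x)) (fun n => by fun_prop)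
    (fun n => Eventually.of_forall fun x =>
      ENNReal.ofReal_le_ofReal (sub_le_self _ n.cast_nonneg))
    hf_int.lintegral_lt_top.ne
    (Eventually.of_forall fun x => tendsto_const_nhds.congr' <| by
      obtain ⟨m, hm⟩ := exists_nat_ge (f x)
      filter_upwards [eventually_ge_atTop m] with n hn
      have hmn : (m : ℝ) ≤ n := by exact_mod_cast hn
      exact (ENNReal.ofReal_of_nonpos (by linarith)).symm)
  simpa using h

/-- The sum over `k` of the weights `t ↦ max (-1) (t / M k)`. -/
noncomputable def truncatedWeight (M : ℕ → ℝ) (t : ℝ) : ℝ := ∑' k, max (-1) (t / M k)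

section truncatedWeight

variable {M : ℕ → ℝ}

lemma abs_max_neg_one_div_le (a : ℝ) : |max (-1) a| ≤ |a| := by
  rcases max_cases (-1) a with ⟨h, h'⟩ | ⟨h, h'⟩ <;> rw [h]
  rw [abs_neg, abs_one, abs_of_neg] <;> grind

lemma summable_max_neg_one_div (hM : Summable fun k => (M k)⁻¹) (t : ℝ) :
    Summable fun k => max (-1) (t / M k) := by
  refine Summable.of_norm_bounded (g := fun k => |t / M k|) ?_ fun k =>
    abs_max_neg_one_div_le _
  simpa [div_eq_mul_inv] using (hM.mul_left t).abs

lemma convexOn_truncatedWeight (hM : Summable fun k => (M k)⁻¹) :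
    ConvexOn ℝ univ (truncatedWeight M) := by
  refine ⟨convex_univ, fun x _ y _ a b ha hb hab => ?_⟩
  have hx := summable_max_neg_one_div hM x
  have hy := summable_max_neg_one_div hM y
  simp only [truncatedWeight, smul_eq_mul]
  rw [← tsum_mul_left, ← tsum_mul_left, ← (hx.mul_left a).tsum_add (hy.mul_left b)]
  refine (summable_max_neg_one_div hM _).tsum_le_tsum (fun k => max_le ?_ ?_)
    ((hx.mul_left a).add (hy.mul_left b))
  · have h1 := mul_le_mul_of_nonneg_left (le_max_left (-1) (x / M k)) ha
    have h2 := mul_le_mul_of_nonneg_left (le_max_left (-1) (y / M k)) hb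
    linarith
  · rw [add_div, mul_div_assoc, mul_div_assoc]
    exact add_le_add (mul_le_mul_of_nonneg_left (le_max_right _ _) ha)
      (mul_le_mul_of_nonneg_left (le_max_right _ _) hb)

lemma monotone_truncatedWeight (hpos : ∀ k, 0 < M k) (hM : Summable fun k => (M k)⁻¹) :
    Monotone (truncatedWeight M) := fun s t hst =>
  (summable_max_neg_one_div hM s).tsum_le_tsum
    (fun k => max_le_max le_rfl (div_le_div_of_nonneg_right hst (hpos k).le))
    (summable_max_neg_one_div hM t)

lemma max_neg_one_div_nonpos (hpos : ∀ k, 0 < M k) {t : ℝ} (ht : t ≤ 0) (k : ℕ) :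
    max (-1) (t / M k) ≤ 0 :=
  max_le (by norm_num) (div_nonpos_of_nonpos_of_nonneg ht (hpos k).le)

lemma truncatedWeight_nonpos (hpos : ∀ k, 0 < M k) {t : ℝ} (ht : t ≤ 0) :
    truncatedWeight M t ≤ 0 :=
  tsum_nonpos (max_neg_one_div_nonpos hpos ht)

lemma tendsto_truncatedWeight_atBot (hpos : ∀ k, 0 < M k)
    (hM : Summable fun k => (M k)⁻¹) : Tendsto (truncatedWeight M) atBot atBot := by
  refine tendsto_atBot.2 fun b => ?_
  obtain ⟨K, hK⟩ := exists_nat_ge (-b)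
  have hlarge : ∀ᶠ t in atBot, ∀ k ∈ Finset.range K, t ≤ -M k :=
    (Finset.eventually_all _).2 fun k _ => eventually_le_atBot _
  filter_upwards [hlarge, eventually_le_atBot 0] with t ht ht0
  have hsum := (summable_max_neg_one_div hM t).neg.sum_le_tsum (Finset.range K)
    fun k _ => neg_nonneg.2 (max_neg_one_div_nonpos hpos ht0 k)
  have heq : ∑ k ∈ Finset.range K, -max (-1) (t / M k) = K := by
    rw [Finset.sum_congr rfl fun k hk => ?_, Finset.sum_const, Finset.card_range, nsmul_one]
    rw [max_eq_left ((div_le_iff₀ (hpos k)).2 (by linarith [ht k hk])), neg_neg]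
  rw [heq, tsum_neg] at hsum
  change truncatedWeight M t ≤ b
  change (K : ℝ) ≤ -truncatedWeight M t at hsum
  linarith

/-- Young-type inequality for the truncated weight with `M k = N k * 2 ^ (k + 1)`. -/
lemma ofReal_neg_truncatedWeight_mul_le {N : ℕ → ℝ} (hN : ∀ k, 0 < N k)
    (hM : Summable fun k => (N k * 2 ^ (k + 1))⁻¹) {t : ℝ} (ht : t ≤ 0) (y : ℝ) :
    ENNReal.ofReal (-truncatedWeight (fun k => N k * 2 ^ (k + 1)) t) * ENNReal.ofReal y ≤
      ENNReal.ofReal (-t) + ∑' k, ENNReal.ofReal (y - N k) := by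
  have hpos : ∀ k, 0 < N k * 2 ^ (k + 1) := fun k => mul_pos (hN k) (by positivity)
  have hnn := fun k => neg_nonneg.2 (max_neg_one_div_nonpos hpos ht k)
  have hgeom : ENNReal.ofReal (-t) = ∑' k : ℕ, ENNReal.ofReal (-t / 2 / 2 ^ k) := by
    rw [← ENNReal.ofReal_tsum_of_nonneg (fun k => by
      have := neg_nonneg.2 ht
      positivity) (summable_geometric_two' _), tsum_geometric_two']
  rw [truncatedWeight, ← tsum_neg,
    ENNReal.ofReal_tsum_of_nonneg hnn (summable_max_neg_one_div hM t).neg,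
    ← ENNReal.tsum_mul_right, hgeom, ← ENNReal.tsum_add]
  refine ENNReal.tsum_le_tsum fun k => ?_
  rw [← ENNReal.ofReal_mul (hnn k)]
  set u := -max (-1) (t / (N k * 2 ^ (k + 1)))
  have hu0 : 0 ≤ u := hnn k
  have hu1 : u ≤ 1 := by linarith [le_max_left (-1) (t / (N k * 2 ^ (k + 1)))]
  have huN : u * N k ≤ -t / 2 / 2 ^ k := by
    have h := mul_le_mul_of_nonneg_right
      (neg_le_neg (le_max_right (-1) (t / (N k * 2 ^ (k + 1))))) (hN k).le
    refine h.trans_eq ?_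
    have := (hN k).ne'
    field_simp
    ring
  have hsplit : u * y ≤ -t / 2 / 2 ^ k + max (y - N k) 0 := by
    have h1 : u * (y - N k) ≤ u * max (y - N k) 0 :=
      mul_le_mul_of_nonneg_left (le_max_left _ _) hu0
    have h2 : u * max (y - N k) 0 ≤ 1 * max (y - N k) 0 :=
      mul_le_mul_of_nonneg_right hu1 (le_max_right _ _)
    linarith
  calc ENNReal.ofReal (u * y) ≤ ENNReal.ofReal (-t / 2 / 2 ^ k + max (y - N k) 0) :=
        ENNReal.ofReal_le_ofReal hsplit
    _ ≤ _ := ENNReal.ofReal_add_le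
    _ = _ := by simp [ENNReal.ofReal_max]

end truncatedWeight

/-- **Uniform energy estimate in the proof of Theorem 4.6 (Theorem A).**
Let `ν` be a finite measure and `f : X → [0,∞)` a `ν`-integrable function.
Then there exist a continuous convex increasing `χ : (-∞,0] → (-∞,0]` with
`χ t → -∞` as `t → -∞` and a constant `C ≥ 0` such that for every measurable
`φ : X → [-∞,0]` one has `∫ (-χ)(φ) · f dν ≤ ∫ (-φ) dν + C` in `[0,∞]`,
with the convention `(-χ)(-∞) = +∞`. -/
theorem exists_weight_uniform_energy_estimate
    {X : Type*} [MeasurableSpace X] (ν : Measure X) [IsFiniteMeasure ν]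
    (f : X → ℝ) (hf_meas : Measurable f) (hf_nn : ∀ x, 0 ≤ f x)
    (hf_int : Integrable f ν) :
    ∃ (χ : ℝ → ℝ) (C : ℝ), 0 ≤ C ∧
      ContinuousOn χ (Iic 0) ∧ ConvexOn ℝ (Iic 0) χ ∧
      MonotoneOn χ (Iic 0) ∧ (∀ t, t ≤ 0 → χ t ≤ 0) ∧
      Tendsto χ atBot atBot ∧
      ∀ φ : X → EReal, Measurable φ → (∀ x, φ x ≤ 0) →
        ∫⁻ x, (if φ x = ⊥ then ⊤ else ENNReal.ofReal (-χ ((φ x).toReal)))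
            * ENNReal.ofReal (f x) ∂ν
          ≤ (∫⁻ x, (if φ x = ⊥ then ⊤ else ENNReal.ofReal (-(φ x).toReal)) ∂ν)
            + ENNReal.ofReal C := by
  have hlevel : ∀ k : ℕ, ∃ n : ℕ, 1 ≤ n ∧
      ∫⁻ x, ENNReal.ofReal (f x - n) ∂ν ≤ ENNReal.ofReal (1 / 2 / 2 ^ k) := fun k =>
    ((eventually_ge_atTop 1).and
      ((tendsto_lintegral_ofReal_sub_nat hf_meas hf_int).eventually_le_const
        (ENNReal.ofReal_pos.2 (by positivity)))).exists
  choose n hn_one hn_int using hlevel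
  have hN1 : ∀ k, (1 : ℝ) ≤ n k := fun k => by exact_mod_cast hn_one k
  have hN : ∀ k, (0 : ℝ) < n k := fun k => one_pos.trans_le (hN1 k)
  have hpos : ∀ k, (0 : ℝ) < n k * 2 ^ (k + 1) := fun k => mul_pos (hN k) (by positivity)
  have hM : Summable fun k => ((n k : ℝ) * 2 ^ (k + 1))⁻¹ := by
    refine Summable.of_nonneg_of_le (fun k => (inv_pos.2 (hpos k)).le) (fun k => ?_)
      (summable_geometric_two' 1)
    calc ((n k : ℝ) * 2 ^ (k + 1))⁻¹ ≤ (2 ^ (k + 1))⁻¹ :=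
          inv_anti₀ (by positivity) (le_mul_of_one_le_left (by positivity) (hN1 k))
      _ = 1 / 2 / 2 ^ k := by rw [pow_succ]; field_simp
  have hconv := convexOn_truncatedWeight hM
  refine ⟨truncatedWeight fun k => n k * 2 ^ (k + 1), 1, zero_le_one,
    (hconv.continuousOn isOpen_univ).mono (subset_univ _),
    hconv.subset (subset_univ _) (convex_Iic 0),
    (monotone_truncatedWeight hpos hM).monotoneOn _,
    fun t ht => truncatedWeight_nonpos hpos ht, tendsto_truncatedWeight_atBot hpos hM,
    fun φ _ hφ => ?_⟩
  have hG : ∫⁻ x, ∑' k, ENNReal.ofReal (f x - n k) ∂ν ≤ ENNReal.ofReal 1 := by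
    rw [lintegral_tsum fun k => by fun_prop, ← tsum_geometric_two' 1,
      ENNReal.ofReal_tsum_of_nonneg (fun k => by positivity) (summable_geometric_two' 1)]
    exact ENNReal.tsum_le_tsum hn_int
  refine le_trans ?_ (add_le_add le_rfl hG)
  rw [← lintegral_add_right _ (by fun_prop)]
  refine lintegral_mono fun x => ?_
  by_cases hx : φ x = ⊥
  · simp [hx]
  · simp only [if_neg hx]
    exact ofReal_neg_truncatedWeight_mul_le hN hM (EReal.toReal_nonpos (hφ x)) (f x)
end
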